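/- Let σ > 0, −1 < ρ < 1, μ₁, μ₂ ∈ ℝ and ν > 0, and consider the bivariate Student-t joint density f(y, u) := (1/(2π σ √(1 − ρ²))) (1 + q(y − μ₁, u − μ₂)/ν)^{−(ν+2)/2}. Then for every u ∈ ℝ, ∫_ℝ f(y, u) dy = f_ν(u − μ₂); consequently ∫_ℝ ∫₀^∞ f(y, u) du dy = F_ν(μ₂), i.e. P(U* > 0) = F_ν(μ₂) in the Heckman-Student-t model. -/

import Mathlib

open MeasureTheory Real Set

/-- The Student-`t` probability density function with `ν` degrees of freedom:
`f_ν(t) = Γ((ν+1)/2)/(√(νπ) Γ(ν/2)) (1 + t²/ν)^(-(ν+1)/2)`. -/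
noncomputable def studentPDF (ν t : ℝ) : ℝ :=
  Real.Gamma ((ν + 1) / 2) / (Real.sqrt (ν * π) * Real.Gamma (ν / 2)) *
    (1 + t ^ 2 / ν) ^ (-(ν + 1) / 2)

/-- The Student-`t` cumulative distribution function with `ν` degrees of
freedom. -/
noncomputable def studentCDF (ν x : ℝ) : ℝ := ∫ t in Iic x, studentPDF ν t

/-- The quadratic form of the matrix `Σ = [[σ², ρσ], [ρσ, 1]]`. -/
noncomputable def quadForm (σ ρ a b : ℝ) : ℝ :=
  (a ^ 2 / σ ^ 2 - 2 * ρ * a * b / σ + b ^ 2) / (1 - ρ ^ 2)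

/-- The bivariate Student-`t` joint density with `ν` degrees of freedom,
location `(μ₁, μ₂)` and covariance matrix `Σ = [[σ², ρσ], [ρσ, 1]]`. -/
noncomputable def bistudentDensity (ν σ ρ μ₁ μ₂ y u : ℝ) : ℝ :=
  (1 / (2 * π * σ * Real.sqrt (1 - ρ ^ 2))) *
    (1 + quadForm σ ρ (y - μ₁) (u - μ₂) / ν) ^ (-(ν + 2) / 2)

theorem integrable_one_add_sq_rpow_neg {s : ℝ} (hs : 1 / 2 < s) :
    Integrable fun x : ℝ => (1 + x ^ 2) ^ (-s) := by
  have h := integrable_rpow_neg_one_add_norm_sq (E := ℝ) (μ := volume) (r := 2 * s)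
    (by simp only [Module.finrank_self, Nat.cast_one]; linarith)
  refine h.congr (.of_forall fun x => ?_)
  simp only [Real.norm_eq_abs, sq_abs]
  congr 1
  ring

theorem integral_one_add_sq_rpow_neg {s : ℝ} (hs : 1 / 2 < s) :
    ∫ x : ℝ, (1 + x ^ 2) ^ (-s) = √π * Real.Gamma (s - 1 / 2) / Real.Gamma s := by
  have hs0 : 0 < s := by linarith
  have hΓ : 0 < Real.Gamma s := Real.Gamma_pos_of_pos hs0
  let F : ℝ → ℝ → ℝ := fun x t => t ^ (s - 1) * rexp (-((1 + x ^ 2) * t))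
  have inner (x : ℝ) : ∫ t in Ioi 0, F x t = (1 + x ^ 2) ^ (-s) * Real.Gamma s := by
    have hx : 0 < 1 + x ^ 2 := by positivity
    rw [Real.integral_rpow_mul_exp_neg_mul_Ioi hs0 hx, one_div, Real.inv_rpow hx.le,
      Real.rpow_neg hx.le]
  have hF : Integrable (Function.uncurry F) (volume.prod (volume.restrict (Ioi 0))) := by
    rw [integrable_prod_iff (by unfold F; fun_prop)]
    refine ⟨.of_forall fun x => ?_, ?_⟩
    · have h := integrableOn_rpow_mul_exp_neg_mul_rpow (p := 1) (s := s - 1) (b := 1 + x ^ 2)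
        (by linarith) one_pos (by positivity)
      refine Integrable.congr h (.of_forall fun t => ?_)
      simp only [F, Function.uncurry_apply_pair, Real.rpow_one, neg_mul]
    · refine ((integrable_one_add_sq_rpow_neg hs).mul_const (Real.Gamma s)).congr
        (.of_forall fun x => ?_)
      change (1 + x ^ 2) ^ (-s) * Real.Gamma s = ∫ t in Ioi 0, ‖F x t‖
      rw [← inner]
      refine setIntegral_congr_fun measurableSet_Ioi fun t ht => ?_
      have ht0 : (0 : ℝ) < t := ht
      exact (Real.norm_of_nonneg (by positivity)).symm
  rw [eq_div_iff hΓ.ne', ← integral_mul_const]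
  simp_rw [← inner]
  rw [integral_integral_swap hF]
  have h := Real.integral_rpow_mul_exp_neg_mul_Ioi (a := s - 1 / 2) (r := 1)
    (by linarith) one_pos
  rw [div_one, Real.one_rpow, one_mul] at h
  rw [← h, ← integral_const_mul]
  refine setIntegral_congr_fun measurableSet_Ioi fun t ht => ?_
  have ht0 : (0 : ℝ) < t := ht
  have e (x : ℝ) : F x t = t ^ (s - 1) * rexp (-(1 * t)) * rexp (-t * x ^ 2) := by
    simp only [F]
    rw [mul_assoc, ← Real.exp_add]
    ring_nf
  simp only [e]
  rw [integral_const_mul, integral_gaussian, Real.sqrt_div pi_pos.le, Real.sqrt_eq_rpow t,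
    show s - 1 / 2 - 1 = s - 1 - 1 / 2 by ring, Real.rpow_sub ht0 (s - 1)]
  ring

/-- Completing the square in the first argument. -/
theorem one_add_quadForm_div {σ ρ ν : ℝ} (hσ : 0 < σ) (hρ : 0 < 1 - ρ ^ 2) (hν : 0 < ν)
    (a b : ℝ) :
    1 + quadForm σ ρ a b / ν = (1 + b ^ 2 / ν) *
      (1 + ((a - σ * ρ * b) / (σ * √(1 - ρ ^ 2) * √ν * √(1 + b ^ 2 / ν))) ^ 2) := by
  have hA : 0 < 1 + b ^ 2 / ν := by positivity
  rw [div_pow, mul_pow, mul_pow, mul_pow, Real.sq_sqrt hρ.le, Real.sq_sqrt hν.le,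
    Real.sq_sqrt hA.le]
  unfold quadForm
  field_simp
  ring

theorem bistudentDensity_eq {σ ρ ν : ℝ} (hσ : 0 < σ) (hρ : 0 < 1 - ρ ^ 2) (hν : 0 < ν)
    (μ₁ μ₂ y u : ℝ) :
    bistudentDensity ν σ ρ μ₁ μ₂ y u =
      1 / (2 * π * σ * √(1 - ρ ^ 2)) * (1 + (u - μ₂) ^ 2 / ν) ^ (-((ν + 2) / 2)) *
        (1 + ((y - (μ₁ + σ * ρ * (u - μ₂))) /
          (σ * √(1 - ρ ^ 2) * √ν * √(1 + (u - μ₂) ^ 2 / ν))) ^ 2) ^ (-((ν + 2) / 2)) := by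
  rw [bistudentDensity, one_add_quadForm_div hσ hρ hν, neg_div,
    Real.mul_rpow (by positivity) (by positivity), sub_sub, mul_assoc (1 / _)]

theorem bistudentDensity_nonneg {σ ρ ν : ℝ} (hσ : 0 < σ) (hρ : 0 < 1 - ρ ^ 2) (hν : 0 < ν)
    (μ₁ μ₂ y u : ℝ) : 0 ≤ bistudentDensity ν σ ρ μ₁ μ₂ y u := by
  rw [bistudentDensity_eq hσ hρ hν]
  positivity

theorem integrable_bistudentDensity_left {σ ρ ν : ℝ} (hσ : 0 < σ) (hρ : 0 < 1 - ρ ^ 2)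
    (hν : 0 < ν) (μ₁ μ₂ u : ℝ) :
    Integrable fun y => bistudentDensity ν σ ρ μ₁ μ₂ y u := by
  simp only [bistudentDensity_eq hσ hρ hν]
  have hd : σ * √(1 - ρ ^ 2) * √ν * √(1 + (u - μ₂) ^ 2 / ν) ≠ 0 := by positivity
  exact (((integrable_one_add_sq_rpow_neg (s := (ν + 2) / 2) (by linarith)).comp_div
    hd).comp_sub_right _).const_mul _

theorem integral_bistudentDensity_left {σ ρ ν : ℝ} (hσ : 0 < σ) (hρ : 0 < 1 - ρ ^ 2)
    (hν : 0 < ν) (μ₁ μ₂ u : ℝ) :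
    ∫ y, bistudentDensity ν σ ρ μ₁ μ₂ y u = studentPDF ν (u - μ₂) := by
  simp only [bistudentDensity_eq hσ hρ hν]
  set A : ℝ := 1 + (u - μ₂) ^ 2 / ν with hA
  have hA0 : 0 < A := by positivity
  set d : ℝ := σ * √(1 - ρ ^ 2) * √ν * √A with hd
  have hd0 : 0 < d := by positivity
  rw [integral_const_mul, integral_sub_right_eq_self
    (fun y => (1 + (y / d) ^ 2) ^ (-((ν + 2) / 2))), Measure.integral_comp_div
    (fun y => (1 + y ^ 2) ^ (-((ν + 2) / 2))), integral_one_add_sq_rpow_neg (by linarith),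
    abs_of_pos hd0, smul_eq_mul, studentPDF, ← hA, show (ν + 2) / 2 = ν / 2 + 1 by ring,
    Real.Gamma_add_one (by positivity), show ν / 2 + 1 - 1 / 2 = (ν + 1) / 2 by ring,
    Real.sqrt_mul hν.le, hd, show -(ν / 2 + 1) = -(ν + 1) / 2 - 1 / 2 by ring,
    Real.rpow_sub hA0, ← Real.sqrt_eq_rpow]
  have hΓ : 0 < Real.Gamma (ν / 2) := Real.Gamma_pos_of_pos (by positivity)
  have hπ : √π ^ 2 = π := Real.sq_sqrt pi_pos.le
  have hν2 : √ν ^ 2 = ν := Real.sq_sqrt hν.le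
  have hπ0 : 0 < √π := Real.sqrt_pos.2 pi_pos
  have hν0 : 0 < √ν := Real.sqrt_pos.2 hν
  have hA1 : 0 < √A := Real.sqrt_pos.2 hA0
  have hρ1 : 0 < √(1 - ρ ^ 2) := Real.sqrt_pos.2 hρ
  field_simp
  rw [hπ, hν2]
  ring

theorem integrable_studentPDF {ν : ℝ} (hν : 0 < ν) : Integrable (studentPDF ν) := by
  have h := ((integrable_one_add_sq_rpow_neg (s := (ν + 1) / 2) (by linarith)).comp_div
    (Real.sqrt_pos.2 hν).ne').const_mul
      (Real.Gamma ((ν + 1) / 2) / (√(ν * π) * Real.Gamma (ν / 2)))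
  refine h.congr (.of_forall fun t => ?_)
  simp only [studentPDF, div_pow, Real.sq_sqrt hν.le, neg_div]

theorem studentPDF_neg (ν t : ℝ) : studentPDF ν (-t) = studentPDF ν t := by
  simp [studentPDF]

theorem integral_Ioi_studentPDF_sub (ν μ : ℝ) :
    ∫ u in Ioi (0 : ℝ), studentPDF ν (u - μ) = studentCDF ν μ := by
  have h := (measurePreserving_sub_right volume μ).setIntegral_preimage_emb
    (MeasurableEquiv.subRight μ).measurableEmbedding (studentPDF ν) (Ioi (-μ))
  rw [Set.preimage_sub_const_Ioi, neg_add_cancel] at h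
  rw [h, studentCDF, ← integral_comp_neg_Iic]
  simp only [studentPDF_neg]

theorem integrable_bistudentDensity {σ ρ ν : ℝ} (hσ : 0 < σ) (hρ : 0 < 1 - ρ ^ 2)
    (hν : 0 < ν) (μ₁ μ₂ : ℝ) (s : Set ℝ) :
    Integrable (Function.uncurry (bistudentDensity ν σ ρ μ₁ μ₂))
      (volume.prod (volume.restrict s)) := by
  have hm : Measurable (Function.uncurry (bistudentDensity ν σ ρ μ₁ μ₂)) := by
    unfold bistudentDensity quadForm
    fun_prop
  rw [integrable_prod_iff' hm.aestronglyMeasurable]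
  refine ⟨.of_forall fun u => integrable_bistudentDensity_left hσ hρ hν μ₁ μ₂ u, ?_⟩
  simp only [Function.uncurry_apply_pair,
    Real.norm_of_nonneg (bistudentDensity_nonneg hσ hρ hν _ _ _ _),
    integral_bistudentDensity_left hσ hρ hν]
  exact ((integrable_studentPDF hν).comp_sub_right μ₂).integrableOn

/-- For the bivariate Student-`t` joint density, for every `u`,
`∫_ℝ f(y, u) dy = f_ν(u - μ₂)`; consequently
`∫_ℝ ∫₀^∞ f(y, u) du dy = F_ν(μ₂)`, i.e. `P(U* > 0) = F_ν(μ₂)` in the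
Heckman-Student-`t` model. -/
theorem heckman_student_selection_probability
    (σ ρ μ₁ μ₂ ν : ℝ) (hσ : 0 < σ) (hρ₁ : -1 < ρ) (hρ₂ : ρ < 1) (hν : 0 < ν) :
    (∀ u : ℝ,
      ∫ y, bistudentDensity ν σ ρ μ₁ μ₂ y u = studentPDF ν (u - μ₂))
    ∧ (∫ y, ∫ u in Ioi (0 : ℝ), bistudentDensity ν σ ρ μ₁ μ₂ y u
        = studentCDF ν μ₂) := by
  have hρ : 0 < 1 - ρ ^ 2 := by nlinarith
  refine ⟨integral_bistudentDensity_left hσ hρ hν μ₁ μ₂, ?_⟩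
  rw [integral_integral_swap (integrable_bistudentDensity hσ hρ hν μ₁ μ₂ _)]
  simp only [integral_bistudentDensity_left hσ hρ hν]
  exact integral_Ioi_studentPDF_sub ν μ₂
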